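/- Let n ≥ 2 be an integer, let C > 0, and let K : ℤ² → (0,∞) be a kernel satisfying K(m) ≤ C·(1+|m|²)^{−1} for all m ∈ ℤ². Then for every ε ∈ (0,1) there exists a constant C_ε > 0, depending only on C, n, ε, such that for every N ≥ 1 and every m ∈ ℤ²: if |m| ≥ N then K⋆ⁿ_{>N}K(m) ≤ C_ε·(1+|m|²)^{ε−1}, and if |m| < N then K⋆ⁿ_{>N}K(m) ≤ C_ε·(1+N²)^{ε−1}. -/

import Mathlib

open scoped BigOperators

/-- Squared Euclidean norm of a lattice point of `ℤ²`. -/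
noncomputable def nsq (m : ℤ × ℤ) : ℝ := (m.1 : ℝ) ^ 2 + (m.2 : ℝ) ^ 2

/-- Euclidean norm of a lattice point of `ℤ²`. -/
noncomputable def norm2 (m : ℤ × ℤ) : ℝ := Real.sqrt (nsq m)

/-- Convolution of two kernels on `ℤ²`: `K₁⋆K₂(m) = Σ_{l∈ℤ²} K₁(m−l)K₂(l)`. -/
noncomputable def conv (K₁ K₂ : ℤ × ℤ → ℝ) (m : ℤ × ℤ) : ℝ :=
  ∑' l : ℤ × ℤ, K₁ (m - l) * K₂ l

/-- Truncated convolution: `K₁⋆_{≤N}K₂(m) = Σ_{|l|≤N} K₁(m−l)K₂(l)`. -/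
noncomputable def convLE (N : ℕ) (K₁ K₂ : ℤ × ℤ → ℝ) (m : ℤ × ℤ) : ℝ :=
  ∑' l : ℤ × ℤ,
    Set.indicator {l : ℤ × ℤ | norm2 l ≤ (N : ℝ)} (fun l => K₁ (m - l) * K₂ l) l

/-- Iterated convolution `K⋆ⁿK`, with `K⋆¹K = K` and `K⋆ⁿK = K⋆(K⋆ⁿ⁻¹K)`. -/
noncomputable def iterConv (K : ℤ × ℤ → ℝ) : ℕ → ℤ × ℤ → ℝ
  | 0 => fun _ => 0
  | 1 => K
  | (n + 2) => conv K (iterConv K (n + 1))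

/-- Truncated iterated convolution `K⋆ⁿ_{≤N}K`, with `K⋆¹_{≤N}K = K` and
`K⋆ⁿ_{≤N}K = K⋆_{≤N}(K⋆ⁿ⁻¹_{≤N}K)`. -/
noncomputable def iterConvLE (N : ℕ) (K : ℤ × ℤ → ℝ) : ℕ → ℤ × ℤ → ℝ
  | 0 => fun _ => 0
  | 1 => K
  | (n + 2) => convLE N K (iterConvLE N K (n + 1))

/-- Tail of the iterated convolution: `K⋆ⁿ_{>N}K = K⋆ⁿK − K⋆ⁿ_{≤N}K`. -/
noncomputable def iterConvGT (N : ℕ) (K : ℤ × ℤ → ℝ) (n : ℕ) (m : ℤ × ℤ) : ℝ :=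
  iterConv K n m - iterConvLE N K n m


lemma nsq_nonneg' (m : ℤ × ℤ) : 0 ≤ nsq m := by unfold nsq; positivity

lemma one_le_w (m : ℤ × ℤ) : 1 ≤ 1 + nsq m := by linarith [nsq_nonneg' m]

lemma w_pos (m : ℤ × ℤ) : 0 < 1 + nsq m := by linarith [nsq_nonneg' m]

lemma summable_one_dim (t : ℝ) (ht : 1 < t) :
    Summable (fun a : ℤ => (1 + (a : ℝ) ^ 2) ^ (-(t / 2))) := by
  have h1 : Summable (fun a : ℤ => |(a : ℝ)| ^ (-t)) := Real.summable_abs_int_rpow ht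
  have h2 : Summable (fun a : ℤ => if a = 0 then (1 : ℝ) else 0) :=
    summable_of_ne_finset_zero (s := {0}) (by intro b hb; simp at hb; simp [hb])
  refine Summable.of_nonneg_of_le (fun a => by positivity) (fun a => ?_) (h1.add h2)
  by_cases ha : a = 0
  · subst ha
    simp
    positivity
  · simp only [ha, if_false, add_zero]
    have hpos : 0 < |(a : ℝ)| := by simpa using ha
    have : |(a : ℝ)| ^ (-t) = ((a : ℝ) ^ 2) ^ (-(t / 2)) := by
      rw [← sq_abs, ← Real.rpow_natCast, ← Real.rpow_mul hpos.le]
      congr 1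
      push_cast
      ring
    rw [this]
    apply Real.rpow_le_rpow_of_nonpos
    · positivity
    · linarith
    · linarith

lemma summable_w (t : ℝ) (ht : 1 < t) :
    Summable (fun l : ℤ × ℤ => (1 + nsq l) ^ (-t)) := by
  have h := summable_one_dim t ht
  have h2 := h.mul_of_nonneg h (fun a => by positivity) (fun a => by positivity)
  refine Summable.of_nonneg_of_le (fun a => Real.rpow_nonneg (w_pos a).le _) (fun a => ?_) h2
  have e : (1 + nsq a) ^ (-t) = ((1 + nsq a) ^ 2) ^ (-(t / 2)) := by
    rw [← Real.rpow_natCast, ← Real.rpow_mul (w_pos a).le]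
    congr 1
    push_cast
    ring
  rw [e, ← Real.mul_rpow (by positivity) (by positivity)]
  apply Real.rpow_le_rpow_of_nonpos
  · positivity
  · unfold nsq
    nlinarith [sq_nonneg (a.1 : ℝ), sq_nonneg (a.2 : ℝ),
      mul_nonneg (sq_nonneg (a.1 : ℝ)) (sq_nonneg (a.2 : ℝ)), sq_nonneg ((a.1 : ℝ) ^ 2),
      sq_nonneg ((a.2 : ℝ) ^ 2)]
  · linarith

lemma young_pt (a b x y : ℝ) (ha : 1 ≤ a) (hb : 1 ≤ b) (hx : 0 ≤ x) (hy : 0 ≤ y) :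
    a ^ (-x) * b ^ (-y) ≤ a ^ (-(x + y)) + b ^ (-(x + y)) := by
  have ha0 : 0 < a := by linarith
  have hb0 : 0 < b := by linarith
  rw [neg_add, Real.rpow_add ha0, Real.rpow_add hb0]
  have pax : 0 < a ^ (-x) := Real.rpow_pos_of_pos ha0 _
  have pay : 0 < a ^ (-y) := Real.rpow_pos_of_pos ha0 _
  have pbx : 0 < b ^ (-x) := Real.rpow_pos_of_pos hb0 _
  have pby : 0 < b ^ (-y) := Real.rpow_pos_of_pos hb0 _
  rcases le_total a b with h | h
  · have : b ^ (-y) ≤ a ^ (-y) := Real.rpow_le_rpow_of_nonpos ha0 h (by linarith)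
    nlinarith [mul_pos pbx pby]
  · have : a ^ (-x) ≤ b ^ (-x) := Real.rpow_le_rpow_of_nonpos hb0 h (by linarith)
    nlinarith [mul_pos pax pay]

noncomputable def SS (t : ℝ) : ℝ := 2 * ∑' l : ℤ × ℤ, (1 + nsq l) ^ (-t)

lemma young_sum (x y t : ℝ) (hx : 0 ≤ x) (hy : 0 ≤ y) (hxy : x + y = t) (ht : 1 < t)
    (m : ℤ × ℤ) :
    Summable (fun l : ℤ × ℤ => (1 + nsq (m - l)) ^ (-x) * (1 + nsq l) ^ (-y)) ∧
    ∑' l : ℤ × ℤ, (1 + nsq (m - l)) ^ (-x) * (1 + nsq l) ^ (-y) ≤ SS t := by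
  subst hxy
  have h1 := summable_w _ ht
  have h2 : Summable (fun l : ℤ × ℤ => (1 + nsq (m - l)) ^ (-(x + y))) :=
    (Equiv.subLeft m).summable_iff.mpr h1
  have e2 : ∑' l : ℤ × ℤ, (1 + nsq (m - l)) ^ (-(x + y))
      = ∑' l : ℤ × ℤ, (1 + nsq l) ^ (-(x + y)) :=
    (Equiv.subLeft m).tsum_eq (fun l : ℤ × ℤ => (1 + nsq l) ^ (-(x + y)))
  have hle : ∀ l : ℤ × ℤ, (1 + nsq (m - l)) ^ (-x) * (1 + nsq l) ^ (-y) ≤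
      (1 + nsq (m - l)) ^ (-(x + y)) + (1 + nsq l) ^ (-(x + y)) :=
    fun l => young_pt _ _ _ _ (one_le_w _) (one_le_w _) hx hy
  have hs : Summable (fun l : ℤ × ℤ => (1 + nsq (m - l)) ^ (-x) * (1 + nsq l) ^ (-y)) :=
    Summable.of_nonneg_of_le (fun l => mul_nonneg (Real.rpow_nonneg (w_pos _).le _)
      (Real.rpow_nonneg (w_pos _).le _)) hle (h2.add h1)
  refine ⟨hs, (hs.tsum_le_tsum hle (h2.add h1)).trans ?_⟩
  rw [h2.tsum_add h1, e2, SS, two_mul]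

lemma SS_pos (t : ℝ) (ht : 1 < t) : 0 < SS t := by
  unfold SS
  have := (summable_w t ht).tsum_pos (fun l => Real.rpow_nonneg (w_pos l).le _) 0
    (Real.rpow_pos_of_pos (w_pos 0) _)
  linarith

lemma w_tri (m l : ℤ × ℤ) : 1 + nsq m ≤ 2 * ((1 + nsq (m - l)) + (1 + nsq l)) := by
  unfold nsq
  push_cast [Prod.fst_sub, Prod.snd_sub]
  nlinarith [sq_nonneg ((m.1 : ℝ) - 2 * l.1), sq_nonneg ((m.2 : ℝ) - 2 * l.2)]

lemma conv_pt (ε : ℝ) (hε0 : 0 < ε) (hε1 : ε < 1) (m l : ℤ × ℤ) :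
    (1 + nsq (m - l)) ^ (-1 : ℝ) * (1 + nsq l) ^ (ε / 2 - 1) ≤
      2 * (1 + nsq m) ^ (ε - 1) *
        ((1 + nsq (m - l)) ^ (-ε) * (1 + nsq l) ^ (-(1 - ε / 2)) +
          (1 + nsq (m - l)) ^ (-1 : ℝ) * (1 + nsq l) ^ (-(ε / 2))) := by
  have key := w_tri m l
  have hw := w_pos m
  have ha := w_pos (m - l)
  have hb := w_pos l
  set w := 1 + nsq m
  set a := 1 + nsq (m - l)
  set b := 1 + nsq l
  have h1 : w ^ (1 - ε) ≤ 2 * (a ^ (1 - ε) + b ^ (1 - ε)) := by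
    calc w ^ (1 - ε) ≤ (2 * (a + b)) ^ (1 - ε) :=
          Real.rpow_le_rpow hw.le key (by linarith)
      _ = 2 ^ (1 - ε) * (a + b) ^ (1 - ε) := Real.mul_rpow (by norm_num) (by positivity)
      _ ≤ 2 * (a ^ (1 - ε) + b ^ (1 - ε)) := by
          have h2 : (2 : ℝ) ^ (1 - ε) ≤ 2 := by
            calc (2 : ℝ) ^ (1 - ε) ≤ 2 ^ (1 : ℝ) :=
                  Real.rpow_le_rpow_of_exponent_le (by norm_num) (by linarith)
              _ = 2 := Real.rpow_one 2
          have h3 : (a + b) ^ (1 - ε) ≤ a ^ (1 - ε) + b ^ (1 - ε) :=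
            Real.rpow_add_le_add_rpow ha.le hb.le (by linarith) (by linarith)
          exact mul_le_mul h2 h3 (by positivity) (by norm_num)
  have ea : a ^ (-ε) = a ^ (1 - ε) * a ^ (-1 : ℝ) := by
    rw [← Real.rpow_add ha]; congr 1; ring
  have eb : b ^ (-(ε / 2)) = b ^ (1 - ε) * b ^ (ε / 2 - 1) := by
    rw [← Real.rpow_add hb]; congr 1; ring
  have eb' : b ^ (-(1 - ε / 2)) = b ^ (ε / 2 - 1) := by congr 1; ring
  have ew : w ^ (ε - 1) * w ^ (1 - ε) = 1 := by
    rw [← Real.rpow_add hw]; simp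
  rw [ea, eb, eb']
  have hp : 0 ≤ w ^ (ε - 1) * (a ^ (-1 : ℝ) * b ^ (ε / 2 - 1)) := by positivity
  calc a ^ (-1 : ℝ) * b ^ (ε / 2 - 1)
      = (w ^ (ε - 1) * w ^ (1 - ε)) * (a ^ (-1 : ℝ) * b ^ (ε / 2 - 1)) := by rw [ew, one_mul]
    _ = (w ^ (ε - 1) * (a ^ (-1 : ℝ) * b ^ (ε / 2 - 1))) * w ^ (1 - ε) := by ring
    _ ≤ (w ^ (ε - 1) * (a ^ (-1 : ℝ) * b ^ (ε / 2 - 1))) *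
          (2 * (a ^ (1 - ε) + b ^ (1 - ε))) := mul_le_mul_of_nonneg_left h1 hp
    _ = _ := by ring

/-- Pointwise bound of the tail, on both regions. -/
lemma split_pow (ε u v : ℝ) (hε0 : 0 < ε) (hε1 : ε < 1) (hu : 0 < u) (huv : u ≤ v) :
    v ^ (ε / 2 - 1) ≤ u ^ (ε - 1) * v ^ (-(ε / 2)) ∧
    v ^ (ε / 2 - 1) ≤ v ^ (ε - 1) * u ^ (-(ε / 2)) := by
  have hv : 0 < v := by linarith
  have e : v ^ (ε / 2 - 1) = v ^ (ε - 1) * v ^ (-(ε / 2)) := by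
    rw [← Real.rpow_add hv]; congr 1; ring
  rw [e]
  constructor
  · exact mul_le_mul_of_nonneg_right
      (Real.rpow_le_rpow_of_nonpos hu huv (by linarith)) (by positivity)
  · exact mul_le_mul_of_nonneg_left
      (Real.rpow_le_rpow_of_nonpos hu huv (by linarith)) (by positivity)

lemma main_bound (C : ℝ) (hC : 0 < C) (n : ℕ) :
    ∀ ε : ℝ, 0 < ε → ε < 1 → ∃ A : ℝ, 0 < A ∧
      ∀ K : ℤ × ℤ → ℝ, (∀ m, 0 < K m) →
        (∀ m, K m ≤ C * (1 + nsq m) ^ (-1 : ℝ)) → ∀ m : ℤ × ℤ,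
          0 ≤ iterConv K (n + 1) m ∧
          iterConv K (n + 1) m ≤ A * (1 + nsq m) ^ (ε - 1) ∧
          ∀ N : ℕ, 0 ≤ iterConvLE N K (n + 1) m ∧
            iterConvLE N K (n + 1) m ≤ iterConv K (n + 1) m ∧
            iterConv K (n + 1) m - iterConvLE N K (n + 1) m ≤
              A * (1 + (N : ℝ) ^ 2) ^ (ε - 1) := by
  induction n with
  | zero =>
    intro ε h0 h1
    refine ⟨C, hC, fun K hK hKC m => ?_⟩
    simp only [zero_add, iterConv, iterConvLE]
    refine ⟨(hK m).le, (hKC m).trans ?_, fun N => ⟨(hK m).le, le_rfl, ?_⟩⟩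
    · exact mul_le_mul_of_nonneg_left
        (Real.rpow_le_rpow_of_exponent_le (one_le_w m) (by linarith)) hC.le
    · rw [sub_self]; positivity
  | succ n ih =>
    intro ε h0 h1
    obtain ⟨A, hA, H⟩ := ih (ε / 2) (by linarith) (by linarith)
    have hB := SS_pos (1 + ε / 2) (by linarith)
    set B := SS (1 + ε / 2) with hBdef
    refine ⟨4 * C * A * B, by positivity, fun K hK hKC m => ?_⟩
    have H := H K hK hKC
    change 0 ≤ conv K (iterConv K (n + 1)) m ∧
      conv K (iterConv K (n + 1)) m ≤ _ ∧
      ∀ N : ℕ, 0 ≤ convLE N K (iterConvLE N K (n + 1)) m ∧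
        convLE N K (iterConvLE N K (n + 1)) m ≤ conv K (iterConv K (n + 1)) m ∧
        conv K (iterConv K (n + 1)) m - convLE N K (iterConvLE N K (n + 1)) m ≤ _
    set F := iterConv K (n + 1) with hF
    obtain ⟨sg, bg⟩ := young_sum ε (1 - ε / 2) (1 + ε / 2) (by linarith) (by linarith)
      (by ring) (by linarith) m
    obtain ⟨sh, bh⟩ := young_sum 1 (ε / 2) (1 + ε / 2) (by linarith) (by linarith)
      (by ring) (by linarith) m
    have hle : ∀ l, K (m - l) * F l ≤ (C * A * (2 * (1 + nsq m) ^ (ε - 1))) *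
        ((1 + nsq (m - l)) ^ (-ε) * (1 + nsq l) ^ (-(1 - ε / 2)) +
          (1 + nsq (m - l)) ^ (-1 : ℝ) * (1 + nsq l) ^ (-(ε / 2))) := by
      intro l
      have p1 : 0 ≤ (1 + nsq (m - l)) ^ (-1 : ℝ) := Real.rpow_nonneg (w_pos _).le _
      calc K (m - l) * F l ≤ (C * (1 + nsq (m - l)) ^ (-1 : ℝ)) *
            (A * (1 + nsq l) ^ (ε / 2 - 1)) :=
            mul_le_mul (hKC _) (H l).2.1 (H l).1 (by positivity)
        _ = C * A * ((1 + nsq (m - l)) ^ (-1 : ℝ) * (1 + nsq l) ^ (ε / 2 - 1)) := by ring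
        _ ≤ C * A * _ := mul_le_mul_of_nonneg_left (conv_pt ε h0 h1 m l) (by positivity)
        _ = _ := by ring
    have hnn : ∀ l, 0 ≤ K (m - l) * F l := fun l => mul_nonneg (hK _).le (H l).1
    have sgh := (sg.add sh).mul_left (C * A * (2 * (1 + nsq m) ^ (ε - 1)))
    have sF : Summable (fun l => K (m - l) * F l) := Summable.of_nonneg_of_le hnn hle sgh
    have pw : 0 < (1 + nsq m) ^ (ε - 1) := Real.rpow_pos_of_pos (w_pos m) _
    refine ⟨tsum_nonneg hnn, ?_, fun N => ?_⟩
    · refine (sF.tsum_le_tsum hle sgh).trans ?_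
      rw [tsum_mul_left, sg.tsum_add sh]
      calc _ ≤ C * A * (2 * (1 + nsq m) ^ (ε - 1)) * (B + B) :=
            mul_le_mul_of_nonneg_left (add_le_add bg bh) (by positivity)
        _ = _ := by ring
    · set G := iterConvLE N K (n + 1) with hG
      have hGnn : ∀ l, 0 ≤ Set.indicator {l : ℤ × ℤ | norm2 l ≤ (N : ℝ)}
          (fun l => K (m - l) * G l) l := fun l =>
        Set.indicator_nonneg (fun l _ => mul_nonneg (hK _).le ((H l).2.2 N).1) l
      have hGle : ∀ l, Set.indicator {l : ℤ × ℤ | norm2 l ≤ (N : ℝ)}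
          (fun l => K (m - l) * G l) l ≤ K (m - l) * F l := fun l =>
        Set.indicator_le' (fun l _ => mul_le_mul_of_nonneg_left ((H l).2.2 N).2.1 (hK _).le)
          (fun l _ => hnn l) l
      have sG := Summable.of_nonneg_of_le hGnn hGle sF
      refine ⟨tsum_nonneg hGnn, sG.tsum_le_tsum hGle sF, ?_⟩
      have hM : 0 < 1 + (N : ℝ) ^ 2 := by positivity
      have pM : 0 < (1 + (N : ℝ) ^ 2) ^ (ε - 1) := Real.rpow_pos_of_pos hM _
      have hD : ∀ l, K (m - l) * F l - Set.indicator {l : ℤ × ℤ | norm2 l ≤ (N : ℝ)}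
          (fun l => K (m - l) * G l) l ≤ (C * A * (1 + (N : ℝ) ^ 2) ^ (ε - 1)) *
            ((1 + nsq (m - l)) ^ (-1 : ℝ) * (1 + nsq l) ^ (-(ε / 2))) := by
        intro l
        have p1 : 0 ≤ (1 + nsq (m - l)) ^ (-1 : ℝ) := Real.rpow_nonneg (w_pos _).le _
        by_cases hl : norm2 l ≤ (N : ℝ)
        · rw [Set.indicator_of_mem (by exact hl), ← mul_sub]
          have hwM : 1 + nsq l ≤ 1 + (N : ℝ) ^ 2 := by
            have := (Real.sqrt_le_left (Nat.cast_nonneg N)).mp hl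
            linarith
          have h2 := (split_pow ε _ _ h0 h1 (w_pos l) hwM).2
          calc K (m - l) * (F l - G l) ≤ (C * (1 + nsq (m - l)) ^ (-1 : ℝ)) *
                (A * ((1 + (N : ℝ) ^ 2) ^ (ε - 1) * (1 + nsq l) ^ (-(ε / 2)))) :=
                mul_le_mul (hKC _) (((H l).2.2 N).2.2.trans
                  (mul_le_mul_of_nonneg_left h2 hA.le))
                  (sub_nonneg.mpr ((H l).2.2 N).2.1) (by positivity)
            _ = _ := by ring
        · rw [Set.indicator_of_notMem (by exact hl), sub_zero]
          have hwM : 1 + (N : ℝ) ^ 2 ≤ 1 + nsq l := by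
            have := (Real.lt_sqrt (Nat.cast_nonneg N)).mp (not_le.mp hl)
            linarith
          have h2 := (split_pow ε _ _ h0 h1 hM hwM).1
          calc K (m - l) * F l ≤ (C * (1 + nsq (m - l)) ^ (-1 : ℝ)) *
                (A * ((1 + (N : ℝ) ^ 2) ^ (ε - 1) * (1 + nsq l) ^ (-(ε / 2)))) :=
                mul_le_mul (hKC _) ((H l).2.1.trans
                  (mul_le_mul_of_nonneg_left h2 hA.le)) (H l).1 (by positivity)
            _ = _ := by ring
      have sh' := sh.mul_left (C * A * (1 + (N : ℝ) ^ 2) ^ (ε - 1))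
      unfold conv convLE
      rw [← sF.tsum_sub sG]
      refine ((sF.sub sG).tsum_le_tsum hD sh').trans ?_
      rw [tsum_mul_left]
      calc _ ≤ C * A * (1 + (N : ℝ) ^ 2) ^ (ε - 1) * B :=
            mul_le_mul_of_nonneg_left bh (by positivity)
        _ ≤ _ := by
          have : 0 < C * A * (1 + (N : ℝ) ^ 2) ^ (ε - 1) * B := by positivity
          nlinarith

theorem stmt_11 (n : ℕ) (hn : 2 ≤ n) (C : ℝ) (hC : 0 < C)
    (ε : ℝ) (hε0 : 0 < ε) (hε1 : ε < 1) :
    ∃ Cε : ℝ, 0 < Cε ∧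
      ∀ K : ℤ × ℤ → ℝ,
        (∀ m, 0 < K m) →
        (∀ m, K m ≤ C * (1 + nsq m) ^ (-1 : ℝ)) →
        ∀ N : ℕ, 1 ≤ N → ∀ m : ℤ × ℤ,
          ((N : ℝ) ≤ norm2 m →
            iterConvGT N K n m ≤ Cε * (1 + nsq m) ^ (ε - 1)) ∧
          (norm2 m < (N : ℝ) →
            iterConvGT N K n m ≤ Cε * (1 + (N : ℝ) ^ 2) ^ (ε - 1)) := by
  obtain ⟨k, rfl⟩ : ∃ k, n = k + 1 := ⟨n - 1, by omega⟩
  obtain ⟨A, hA, H⟩ := main_bound C hC k ε hε0 hε1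
  refine ⟨A, hA, fun K hK hKC N _ m => ⟨fun _ => ?_, fun _ => ?_⟩⟩
  · have h := H K hK hKC m
    have h1 := h.2.1
    have h2 := (h.2.2 N).1
    unfold iterConvGT
    linarith
  · exact ((H K hK hKC m).2.2 N).2.2
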